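/- Let m ≥ 2 and let Φ, Φ₁, …, Φ_m be Young functions. Then the following are equivalent: (1) there exists C > 0 such that ∏_{i=1}^m Φᵢ⁻¹(t) ≤ C·Φ⁻¹(t) for all t ≥ 0; (2) there exists C > 0 such that Φ((∏_{i=1}^m tᵢ)/C) ≤ Σ_{i=1}^m Φᵢ(tᵢ) for all t₁,…,t_m ≥ 0; (3) there exists M > 0 such that ‖∏_{i=1}^m fᵢ‖_{L_Φ} ≤ M·∏_{i=1}^m ‖fᵢ‖_{L_{Φᵢ}} for all fᵢ ∈ L_{Φᵢ}(ℝⁿ), i = 1,…,m; (4) for all fᵢ ∈ L_{Φᵢ}(ℝⁿ), i = 1,…,m, the product ∏_{i=1}^m fᵢ belongs to L_Φ(ℝⁿ). -/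

import Mathlib

open MeasureTheory ENNReal Filter

/-- A Young function: convex on `[0,∞)`, left-continuous, `Φ 0 = 0`,
nonnegative on `[0,∞)`, and `Φ t → ∞` as `t → ∞`. -/
structure IsYoung (Φ : ℝ → ℝ) : Prop where
  nonneg : ∀ t, 0 ≤ t → 0 ≤ Φ t
  convexOn : ConvexOn ℝ (Set.Ici 0) Φ
  leftCont : ∀ t, 0 < t → ContinuousWithinAt Φ (Set.Iic t) t
  map_zero : Φ 0 = 0
  tendsto_top : Tendsto Φ atTop atTop

/-- Generalized inverse `Φ⁻¹(s) = inf {r ≥ 0 : Φ r > s}`. -/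
noncomputable def youngInv (Φ : ℝ → ℝ) (s : ℝ) : ℝ :=
  sInf {r : ℝ | 0 ≤ r ∧ s < Φ r}

/-- The set `{b > 0 : ∫ Φ(|f|/b) dμ ≤ 1}` defining the Luxemburg norm. -/
def orliczSet {α : Type*} [MeasurableSpace α] (μ : Measure α) (Φ : ℝ → ℝ)
    (f : α → ℝ) : Set ℝ :=
  {b : ℝ | 0 < b ∧ ∫⁻ x, ENNReal.ofReal (Φ (|f x| / b)) ∂μ ≤ 1}

/-- The Orlicz (Luxemburg) norm `‖f‖_{L_Φ} = inf {b > 0 : ∫ Φ(|f|/b) dμ ≤ 1}`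
(equal to `∞` when no such `b` exists). -/
noncomputable def orliczNorm {α : Type*} [MeasurableSpace α] (μ : Measure α) (Φ : ℝ → ℝ)
    (f : α → ℝ) : ℝ≥0∞ :=
  ⨅ b ∈ orliczSet μ Φ f, ENNReal.ofReal b

/-- `f ∈ L_Φ`: `f` is measurable and some `b > 0` satisfies `∫ Φ(|f|/b) dμ ≤ 1`. -/
def MemOrlicz {α : Type*} [MeasurableSpace α] (μ : Measure α) (Φ : ℝ → ℝ)
    (f : α → ℝ) : Prop :=
  Measurable f ∧ (orliczSet μ Φ f).Nonempty

/-- The set `{b > 0 : sup_{t>0} Φ(t)·μ{|f|/b > t} ≤ 1}` defining the weak Orlicz quasi-norm. -/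
def wOrliczSet {α : Type*} [MeasurableSpace α] (μ : Measure α) (Φ : ℝ → ℝ)
    (f : α → ℝ) : Set ℝ :=
  {b : ℝ | 0 < b ∧ ∀ t > 0, ENNReal.ofReal (Φ t) * μ {x | t < |f x| / b} ≤ 1}

/-- The weak Orlicz quasi-norm `‖f‖_{wL_Φ}` (equal to `∞` when no admissible `b` exists). -/
noncomputable def wOrliczNorm {α : Type*} [MeasurableSpace α] (μ : Measure α) (Φ : ℝ → ℝ)
    (f : α → ℝ) : ℝ≥0∞ :=
  ⨅ b ∈ wOrliczSet μ Φ f, ENNReal.ofReal b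

/-- `f ∈ wL_Φ`: `f` is measurable and `‖f‖_{wL_Φ} < ∞`. -/
def MemwOrlicz {α : Type*} [MeasurableSpace α] (μ : Measure α) (Φ : ℝ → ℝ)
    (f : α → ℝ) : Prop :=
  Measurable f ∧ wOrliczNorm μ Φ f < ⊤

lemma youngInv_nonneg (Φ : ℝ → ℝ) (s : ℝ) : 0 ≤ youngInv Φ s :=
  Real.sInf_nonneg fun _ hr => hr.1

namespace IsYoung

variable {Φ : ℝ → ℝ}

lemma map_mul_le (h : IsYoung Φ) {c x : ℝ} (hc : 0 ≤ c) (hc1 : c ≤ 1) (hx : 0 ≤ x) :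
    Φ (c * x) ≤ c * Φ x := by
  have := h.convexOn.2 (Set.mem_Ici.2 hx) (Set.mem_Ici.2 le_rfl) hc (sub_nonneg.2 hc1)
    (by ring)
  simpa [h.map_zero] using this

lemma mono (h : IsYoung Φ) {x y : ℝ} (hx : 0 ≤ x) (hxy : x ≤ y) : Φ x ≤ Φ y := by
  rcases hx.eq_or_lt with rfl | hx
  · rw [h.map_zero]
    exact h.nonneg y hxy
  · have hy : 0 < y := hx.trans_le hxy
    have hle : x / y ≤ 1 := (div_le_one hy).2 hxy
    have := h.map_mul_le (div_nonneg hx.le hy.le) hle hy.le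
    rw [div_mul_cancel₀ _ hy.ne'] at this
    exact this.trans (mul_le_of_le_one_left (h.nonneg y hy.le) hle)

lemma measurable_comp_abs_div (h : IsYoung Φ) {α : Type*} [MeasurableSpace α] {f : α → ℝ}
    (hf : Measurable f) {b : ℝ} (hb : 0 < b) : Measurable fun x => Φ (|f x| / b) := by
  have hm : Monotone fun y : ℝ => Φ (max y 0) := fun x y hxy =>
    h.mono (le_max_right _ _) (max_le_max_right 0 hxy)
  have : (fun x => Φ (|f x| / b)) = (fun y : ℝ => Φ (max y 0)) ∘ fun x => |f x| / b := by
    ext x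
    simp [max_eq_left (div_nonneg (abs_nonneg (f x)) hb.le)]
  rw [this]
  exact hm.measurable.comp (hf.abs.div_const b)

lemma youngInv_set_nonempty (h : IsYoung Φ) (s : ℝ) : {r : ℝ | 0 ≤ r ∧ s < Φ r}.Nonempty :=
  ((eventually_ge_atTop 0).and (h.tendsto_top.eventually_gt_atTop s)).exists

lemma le_youngInv (h : IsYoung Φ) {u s : ℝ} (hus : Φ u ≤ s) : u ≤ youngInv Φ s := by
  refine le_csInf (h.youngInv_set_nonempty s) fun r hr => ?_
  by_contra! hlt
  exact (hr.2.trans_le (h.mono hr.1 hlt.le)).not_ge hus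

lemma lt_map_of_youngInv_lt (h : IsYoung Φ) {r s : ℝ} (hr : youngInv Φ s < r) : s < Φ r := by
  obtain ⟨q, hq, hqr⟩ := exists_lt_of_csInf_lt (h.youngInv_set_nonempty s) hr
  exact hq.2.trans_le (h.mono hq.1 hqr.le)

lemma map_youngInv_le (h : IsYoung Φ) {s : ℝ} (hs : 0 ≤ s) : Φ (youngInv Φ s) ≤ s := by
  rcases (youngInv_nonneg Φ s).eq_or_lt with h0 | h0
  · rwa [← h0, h.map_zero]
  · have hc := (h.leftCont _ h0).mono_left (nhdsWithin_mono _ Set.Iio_subset_Iic_self)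
    refine le_of_tendsto hc ?_
    filter_upwards [self_mem_nhdsWithin, Ioo_mem_nhdsLT h0] with u hu hu0
    by_contra! hlt
    have hmem : u ∈ {r : ℝ | 0 ≤ r ∧ s < Φ r} := ⟨hu0.1.le, hlt⟩
    exact (csInf_le ⟨0, fun r hr => hr.1⟩ hmem).not_gt hu

lemma map_le_of_le_youngInv (h : IsYoung Φ) {u s : ℝ} (hu : 0 ≤ u) (hs : 0 ≤ s)
    (hus : u ≤ youngInv Φ s) : Φ u ≤ s :=
  (h.mono hu hus).trans (h.map_youngInv_le hs)

end IsYoung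

section Pointwise

variable {ι : Type*} [Fintype ι] {Φ : ℝ → ℝ} {Φi : ι → ℝ → ℝ}

lemma map_prod_div_le_sum_of_prod_youngInv_le (hΦ : IsYoung Φ) (hΦi : ∀ i, IsYoung (Φi i))
    {C : ℝ} (hC : 0 < C) (h : ∀ t > 0, (∏ i, youngInv (Φi i) t) ≤ C * youngInv Φ t)
    {t : ι → ℝ} (ht : ∀ i, 0 ≤ t i) : Φ ((∏ i, t i) / C) ≤ ∑ i, Φi i (t i) := by
  have hnn : ∀ i, 0 ≤ Φi i (t i) := fun i => (hΦi i).nonneg _ (ht i)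
  refine le_of_forall_pos_le_add fun ε hε => ?_
  have hs : 0 < ∑ i, Φi i (t i) + ε :=
    add_pos_of_nonneg_of_pos (Finset.sum_nonneg fun i _ => hnn i) hε
  refine hΦ.map_le_of_le_youngInv
    (div_nonneg (Finset.prod_nonneg fun i _ => ht i) hC.le) hs.le ?_
  rw [div_le_iff₀' hC]
  refine le_trans (Finset.prod_le_prod (fun i _ => ht i) fun i hi => ?_) (h _ hs)
  refine (hΦi i).le_youngInv ?_
  have := Finset.single_le_sum (fun j _ => hnn j) hi
  linarith

lemma prod_youngInv_le_of_map_prod_div_le_sum [Nonempty ι] (hΦ : IsYoung Φ)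
    (hΦi : ∀ i, IsYoung (Φi i)) {C : ℝ} (hC : 0 < C)
    (h : ∀ t : ι → ℝ, (∀ i, 0 ≤ t i) → Φ ((∏ i, t i) / C) ≤ ∑ i, Φi i (t i))
    {t : ℝ} (ht : 0 ≤ t) :
    (∏ i, youngInv (Φi i) t) ≤ C * Fintype.card ι * youngInv Φ t := by
  have hm : (1 : ℝ) ≤ Fintype.card ι := by exact_mod_cast Fintype.card_pos (α := ι)
  have hm0 : (0 : ℝ) < Fintype.card ι := by linarith
  rw [← div_le_iff₀' (mul_pos hC hm0)]
  refine hΦ.le_youngInv ?_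
  have hP : 0 ≤ (∏ i, youngInv (Φi i) t) / C :=
    div_nonneg (Finset.prod_nonneg fun i _ => youngInv_nonneg _ _) hC.le
  have h1 := hΦ.map_mul_le (inv_nonneg.2 hm0.le) (inv_le_one_of_one_le₀ hm) hP
  have h2 : ∑ i, Φi i (youngInv (Φi i) t) ≤ Fintype.card ι * t := by
    simpa using Finset.sum_le_sum fun i (_ : i ∈ Finset.univ) => (hΦi i).map_youngInv_le ht
  have h3 := (h _ fun i => youngInv_nonneg (Φi i) t).trans h2
  have h4 : (∏ i, youngInv (Φi i) t) / (C * Fintype.card ι)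
      = (Fintype.card ι : ℝ)⁻¹ * ((∏ i, youngInv (Φi i) t) / C) := by
    field_simp
  rw [h4]
  refine h1.trans ?_
  rwa [inv_mul_le_iff₀ hm0]

end Pointwise

section Orlicz

variable {α : Type*} [MeasurableSpace α] {μ : Measure α}

lemma orliczNorm_ne_top_iff {Φ : ℝ → ℝ} {f : α → ℝ} :
    orliczNorm μ Φ f ≠ ⊤ ↔ (orliczSet μ Φ f).Nonempty := by
  constructor
  · intro h
    by_contra hne
    rw [Set.not_nonempty_iff_eq_empty] at hne
    exact h (by simp [orliczNorm, hne])
  · rintro ⟨b, hb⟩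
    exact ne_top_of_le_ne_top ENNReal.ofReal_ne_top (iInf₂_le b hb)

lemma exists_seq_tendsto_orliczNorm {Φ : ℝ → ℝ} {f : α → ℝ}
    (h : (orliczSet μ Φ f).Nonempty) :
    ∃ b : ℕ → ℝ, (∀ k, b k ∈ orliczSet μ Φ f) ∧
      Tendsto (fun k => ENNReal.ofReal (b k)) atTop (nhds (orliczNorm μ Φ f)) := by
  obtain ⟨u, -, hu, hmem⟩ := exists_seq_tendsto_sInf (h.image ENNReal.ofReal)
    (OrderBot.bddBelow _)
  choose b hb hbu using hmem
  refine ⟨b, hb, ?_⟩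
  simp only [hbu, orliczNorm, ← sInf_image]
  exact hu

variable {ι : Type*} [Fintype ι] {Φ : ℝ → ℝ} {Φi : ι → ℝ → ℝ}

lemma prod_mem_orliczSet [Nonempty ι] (hΦ : IsYoung Φ) (hΦi : ∀ i, IsYoung (Φi i))
    {C : ℝ} (hC : 0 < C)
    (h : ∀ t : ι → ℝ, (∀ i, 0 ≤ t i) → Φ ((∏ i, t i) / C) ≤ ∑ i, Φi i (t i))
    {F : ι → α → ℝ} (hF : ∀ i, Measurable (F i)) {b : ι → ℝ}
    (hb : ∀ i, b i ∈ orliczSet μ (Φi i) (F i)) :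
    C * Fintype.card ι * ∏ i, b i ∈ orliczSet μ Φ fun x => ∏ i, F i x := by
  have hm : (1 : ℝ) ≤ Fintype.card ι := by exact_mod_cast Fintype.card_pos (α := ι)
  have hm0 : (0 : ℝ) < Fintype.card ι := by linarith
  have hbp : 0 < ∏ i, b i := Finset.prod_pos fun i _ => (hb i).1
  have hnn : ∀ i x, 0 ≤ |F i x| / b i := fun i x => div_nonneg (abs_nonneg _) (hb i).1.le
  refine ⟨by positivity, ?_⟩
  have key : ∀ x, ENNReal.ofReal (Φ (|∏ i, F i x| / (C * Fintype.card ι * ∏ i, b i))) ≤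
      ENNReal.ofReal (Fintype.card ι : ℝ)⁻¹ *
        ∑ i, ENNReal.ofReal (Φi i (|F i x| / b i)) := by
    intro x
    rw [← ENNReal.ofReal_sum_of_nonneg fun i _ => (hΦi i).nonneg _ (hnn i x),
      ← ENNReal.ofReal_mul (inv_nonneg.2 hm0.le)]
    refine ENNReal.ofReal_le_ofReal ?_
    have h1 : |∏ i, F i x| / (C * Fintype.card ι * ∏ i, b i)
        = (Fintype.card ι : ℝ)⁻¹ * ((∏ i, |F i x| / b i) / C) := by
      rw [Finset.abs_prod, Finset.prod_div_distrib]
      field_simp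
    rw [h1]
    refine (hΦ.map_mul_le (inv_nonneg.2 hm0.le) (inv_le_one_of_one_le₀ hm)
      (div_nonneg (Finset.prod_nonneg fun i _ => hnn i x) hC.le)).trans ?_
    exact mul_le_mul_of_nonneg_left (h _ fun i => hnn i x) (inv_nonneg.2 hm0.le)
  refine (lintegral_mono key).trans ?_
  have hmeas : ∀ i, Measurable fun x => ENNReal.ofReal (Φi i (|F i x| / b i)) := fun i =>
    ((hΦi i).measurable_comp_abs_div (hF i) (hb i).1).ennreal_ofReal
  rw [lintegral_const_mul _ (Finset.measurable_fun_sum _ fun i _ => hmeas i),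
    lintegral_finsetSum _ fun i _ => hmeas i]
  calc _ ≤ ENNReal.ofReal (Fintype.card ι : ℝ)⁻¹ * ∑ _i : ι, 1 := by
        gcongr with i
        exact (hb i).2
    _ = 1 := by
        rw [ENNReal.ofReal_inv_of_pos hm0, ENNReal.ofReal_natCast]
        simp only [Finset.sum_const, Finset.card_univ, nsmul_eq_mul, mul_one]
        exact ENNReal.inv_mul_cancel (by simp) (by simp)

lemma orliczNorm_prod_le [Nonempty ι] (hΦ : IsYoung Φ) (hΦi : ∀ i, IsYoung (Φi i))
    {C : ℝ} (hC : 0 < C)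
    (h : ∀ t : ι → ℝ, (∀ i, 0 ≤ t i) → Φ ((∏ i, t i) / C) ≤ ∑ i, Φi i (t i))
    {F : ι → α → ℝ} (hF : ∀ i, MemOrlicz μ (Φi i) (F i)) :
    orliczNorm μ Φ (fun x => ∏ i, F i x) ≤
      ENNReal.ofReal (C * Fintype.card ι) * ∏ i, orliczNorm μ (Φi i) (F i) := by
  choose b hb hlim using fun i => exists_seq_tendsto_orliczNorm (hF i).2
  have hprod : Tendsto (fun k => ∏ i, ENNReal.ofReal (b i k)) atTop
      (nhds (∏ i, orliczNorm μ (Φi i) (F i))) :=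
    ENNReal.tendsto_finsetProd_of_ne_top _ (fun i _ => hlim i)
      fun i _ => orliczNorm_ne_top_iff.2 (hF i).2
  refine ge_of_tendsto' (ENNReal.Tendsto.const_mul hprod (Or.inr ENNReal.ofReal_ne_top))
    fun k => ?_
  rw [← ENNReal.ofReal_prod_of_nonneg fun i _ => (hb i k).1.le,
    ← ENNReal.ofReal_mul (by positivity)]
  exact iInf₂_le _ (prod_mem_orliczSet hΦ hΦi hC h (fun i => (hF i).1) fun i => hb i k)

lemma lintegral_comp_nat {κ : α → ℕ} (hκ : Measurable κ) (g : ℕ → ℝ≥0∞) :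
    ∫⁻ x, g (κ x) ∂μ = ∑' k, g k * μ (κ ⁻¹' {k}) := by
  rw [← lintegral_map (measurable_of_countable g) hκ, lintegral_countable']
  exact tsum_congr fun k => by rw [Measure.map_apply hκ (measurableSet_singleton k)]

/-- If the level sets of `κ` can have arbitrary prescribed measures, then stability of the
product under `MemOrlicz` forces the inequality between the generalized inverses. -/
lemma exists_prod_youngInv_le_of_memOrlicz (hΦ : IsYoung Φ) (hΦi : ∀ i, IsYoung (Φi i))
    [Nonempty ι]
    (hμ : ∀ w : ℕ → ℝ, (∀ k, 0 ≤ w k) →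
      ∃ κ : α → ℕ, Measurable κ ∧ ∀ k, μ (κ ⁻¹' {k + 1}) = ENNReal.ofReal (w k))
    (h : ∀ F : ι → α → ℝ, (∀ i, MemOrlicz μ (Φi i) (F i)) →
      MemOrlicz μ Φ fun x => ∏ i, F i x) :
    ∃ C > 0, ∀ t > 0, (∏ i, youngInv (Φi i) t) ≤ C * youngInv Φ t := by
  by_contra! hcon
  choose t ht hlt using fun k : ℕ => hcon (4 ^ k) (by positivity)
  obtain ⟨κ, hκ, hκw⟩ := hμ (fun k => 1 / 2 / 2 ^ k / t k)
    fun k => by have := ht k; positivity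
  let a : ι → ℕ → ℝ := fun i k => Nat.casesOn k 0 fun j => youngInv (Φi i) (t j)
  have ha : ∀ i k, 0 ≤ a i k := fun i k => by
    cases k with
    | zero => exact le_rfl
    | succ j => exact youngInv_nonneg _ _
  have hmem : ∀ i, MemOrlicz μ (Φi i) fun x => a i (κ x) := by
    refine fun i => ⟨(measurable_of_countable (a i)).comp hκ, 1, one_pos, ?_⟩
    rw [lintegral_comp_nat hκ fun k => ENNReal.ofReal (Φi i (|a i k| / 1)),
      tsum_eq_zero_add' ENNReal.summable]
    have h0 : ENNReal.ofReal (Φi i (|a i 0| / 1)) = 0 := by simp [a, (hΦi i).map_zero]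
    rw [h0, zero_mul, zero_add]
    calc _ ≤ ∑' k : ℕ, ENNReal.ofReal (1 / 2 / 2 ^ k) := by
          refine ENNReal.tsum_le_tsum fun k => ?_
          rw [hκw, ← ENNReal.ofReal_mul ((hΦi i).nonneg _ (by positivity))]
          refine ENNReal.ofReal_le_ofReal ?_
          rw [abs_of_nonneg (ha i (k + 1)), div_one, mul_div_assoc', div_le_iff₀ (ht k), mul_comm]
          exact mul_le_mul_of_nonneg_left ((hΦi i).map_youngInv_le (ht k).le) (by positivity)
      _ = 1 := by
          rw [← ENNReal.ofReal_tsum_of_nonneg (fun k => by positivity)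
            (summable_geometric_two' 1), tsum_geometric_two' 1, ENNReal.ofReal_one]
  obtain ⟨-, b, hb, hint⟩ := h _ hmem
  rw [lintegral_comp_nat hκ fun k => ENNReal.ofReal (Φ (|∏ i, a i k| / b))] at hint
  obtain ⟨k, hk⟩ := pow_unbounded_of_one_lt (2 * b) one_lt_two
  have hle := (ENNReal.le_tsum (k + 1)).trans hint
  set P := ∏ i, a i (k + 1)
  have hP0 : 0 ≤ P := Finset.prod_nonneg fun i _ => ha i (k + 1)
  have hPt : t k < Φ (P / 4 ^ k) :=
    hΦ.lt_map_of_youngInv_lt ((lt_div_iff₀' (by positivity)).2 (hlt k))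
  rw [hκw, abs_of_nonneg hP0, ← ENNReal.ofReal_mul (hΦ.nonneg _ (by positivity)),
    ENNReal.ofReal_le_one] at hle
  have htk := ht k
  have h2 : (1 : ℝ) ≤ 2 ^ k := one_le_pow₀ one_le_two
  have h4 : (4 : ℝ) ^ k = 2 ^ k * 2 ^ k := by rw [← mul_pow]; norm_num
  have hb4 : b / 4 ^ k ≤ 1 := by
    rw [div_le_one (by positivity), h4]
    nlinarith
  have hscale := hΦ.map_mul_le (by positivity) hb4 (x := P / b) (by positivity)
  rw [show b / 4 ^ k * (P / b) = P / 4 ^ k by field_simp] at hscale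
  have hlow := hPt.trans_le hscale
  rw [mul_div_assoc', div_le_iff₀ htk, one_mul, div_div, mul_div_assoc', mul_one,
    div_le_iff₀ (by positivity)] at hle
  have hup : b / 4 ^ k * Φ (P / b) ≤ b / 4 ^ k * (t k * (2 * 2 ^ k)) :=
    mul_le_mul_of_nonneg_left hle (by positivity)
  have heq : b / 4 ^ k * (t k * (2 * 2 ^ k)) = t k * (2 * b / 2 ^ k) := by
    rw [h4]
    field_simp
  have hone : 2 * b / 2 ^ k < 1 := (div_lt_one (by positivity)).2 hk
  have := mul_lt_of_lt_one_right htk hone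
  linarith

end Orlicz

/-- Euclidean space admits a measurable `ℕ`-valued map whose level sets are shells of
prescribed volumes. -/
lemma exists_measurable_nat_volume_preimage {n : ℕ} (hn : 0 < n) (w : ℕ → ℝ)
    (hw : ∀ k, 0 ≤ w k) :
    ∃ κ : EuclideanSpace ℝ (Fin n) → ℕ, Measurable κ ∧
      ∀ k, volume (κ ⁻¹' {k + 1}) = ENNReal.ofReal (w k) := by
  have : Nonempty (Fin n) := ⟨⟨0, hn⟩⟩
  set v := (volume (Metric.ball (0 : EuclideanSpace ℝ (Fin n)) 1)).toReal with hv
  have hvtop : volume (Metric.ball (0 : EuclideanSpace ℝ (Fin n)) 1) ≠ ⊤ :=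
    measure_ball_lt_top.ne
  have hv0 : 0 < v := ENNReal.toReal_pos (Metric.measure_ball_pos _ _ one_pos).ne' hvtop
  let S : ℕ → ℝ := fun k => ∑ j ∈ Finset.range k, w j
  have hS0 : ∀ k, 0 ≤ S k := fun k => Finset.sum_nonneg fun j _ => hw j
  have hSsucc : ∀ k, S (k + 1) = S k + w k := fun k => Finset.sum_range_succ _ _
  let r : ℕ → ℝ := fun k => (S k / v) ^ ((n : ℝ)⁻¹)
  have hr0 : ∀ k, 0 ≤ r k := fun k => Real.rpow_nonneg (div_nonneg (hS0 k) hv0.le) _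
  have hr : Monotone r := monotone_nat_of_le_succ fun k => by
    refine Real.rpow_le_rpow (div_nonneg (hS0 k) hv0.le) ?_ (by positivity)
    have := hw k
    rw [hSsucc]
    gcongr
    linarith
  let B : ℕ → Set (EuclideanSpace ℝ (Fin n)) := fun k => Metric.ball 0 (r k)
  have hB : Monotone B := fun i j hij => Metric.ball_subset_ball (hr hij)
  have hBv : ∀ k, volume (B k) = ENNReal.ofReal (S k) := fun k => by
    simp only [B]
    rw [Measure.addHaar_ball _ _ (hr0 k), finrank_euclideanSpace_fin,
      ← ENNReal.ofReal_toReal hvtop, ← hv, ← ENNReal.ofReal_mul (pow_nonneg (hr0 k) _),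
      Real.rpow_inv_natCast_pow (div_nonneg (hS0 k) hv0.le) hn.ne',
      div_mul_cancel₀ _ hv0.ne']
  have hBm : ∀ k, MeasurableSet (B k) := fun k => measurableSet_ball
  let κ : EuclideanSpace ℝ (Fin n) → ℕ := fun x => sInf {k | x ∈ B k}
  have hκ : ∀ k, κ ⁻¹' {k + 1} = B (k + 1) \ B k := fun k => by
    ext x
    simp only [κ, Set.mem_preimage, Set.mem_singleton_iff, Set.mem_sdiff]
    exact Nat.sInf_upward_closed_eq_succ_iff (fun i j hij hi => hB hij hi) k
  have hκm : ∀ k, MeasurableSet (κ ⁻¹' {k + 1}) := fun k => by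
    rw [hκ]
    exact (hBm _).diff (hBm _)
  refine ⟨κ, measurable_to_countable' fun k => ?_, fun k => ?_⟩
  · cases k with
    | succ k => exact hκm k
    | zero =>
      have : κ ⁻¹' {0} = (⋃ k, κ ⁻¹' {k + 1})ᶜ := by
        ext x
        simp only [Set.mem_preimage, Set.mem_singleton_iff, Set.mem_compl_iff, Set.mem_iUnion,
          not_exists]
        constructor
        · intro h k
          omega
        · intro h
          by_contra h0
          obtain ⟨k, hk⟩ := Nat.exists_eq_succ_of_ne_zero h0
          exact h k hk
      rw [this]
      exact (MeasurableSet.iUnion hκm).compl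
  · rw [hκ, measure_sdiff (hB k.le_succ) (hBm k).nullMeasurableSet
      (by rw [hBv]; exact ENNReal.ofReal_ne_top), hBv, hBv, ← ENNReal.ofReal_sub _ (hS0 k),
      hSsucc, add_sub_cancel_left]

/-- Generalized Hölder's inequality in Orlicz spaces: four equivalent conditions. -/
theorem generalized_holder_orlicz_tfae {n : ℕ} (hn : 0 < n) (m : ℕ) (hm : 2 ≤ m)
    (Φ : ℝ → ℝ) (Φi : Fin m → ℝ → ℝ)
    (hΦ : IsYoung Φ) (hΦi : ∀ i, IsYoung (Φi i)) :
    List.TFAE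
      [ ∃ C > 0, ∀ t ≥ 0, (∏ i, youngInv (Φi i) t) ≤ C * youngInv Φ t,
        ∃ C > 0, ∀ t : Fin m → ℝ, (∀ i, 0 ≤ t i) →
          Φ ((∏ i, t i) / C) ≤ ∑ i, Φi i (t i),
        ∃ M > 0, ∀ F : Fin m → EuclideanSpace ℝ (Fin n) → ℝ,
          (∀ i, MemOrlicz (volume : Measure (EuclideanSpace ℝ (Fin n))) (Φi i) (F i)) →
          orliczNorm volume Φ (fun x => ∏ i, F i x) ≤
            ENNReal.ofReal M * ∏ i, orliczNorm volume (Φi i) (F i),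
        ∀ F : Fin m → EuclideanSpace ℝ (Fin n) → ℝ,
          (∀ i, MemOrlicz (volume : Measure (EuclideanSpace ℝ (Fin n))) (Φi i) (F i)) →
          MemOrlicz (volume : Measure (EuclideanSpace ℝ (Fin n))) Φ (fun x => ∏ i, F i x) ] := by
  have : Nonempty (Fin m) := ⟨⟨0, by omega⟩⟩
  have hm0 : (0 : ℝ) < Fintype.card (Fin m) := by exact_mod_cast Fintype.card_pos
  tfae_have 1 → 2 := by
    rintro ⟨C, hC, h⟩
    exact ⟨C, hC, fun t ht => map_prod_div_le_sum_of_prod_youngInv_le hΦ hΦi hC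
      (fun s hs => h s (le_of_lt hs)) ht⟩
  tfae_have 2 → 1 := by
    rintro ⟨C, hC, h⟩
    exact ⟨_, mul_pos hC hm0, fun t ht =>
      prod_youngInv_le_of_map_prod_div_le_sum hΦ hΦi hC h ht⟩
  tfae_have 2 → 3 := by
    rintro ⟨C, hC, h⟩
    exact ⟨_, mul_pos hC hm0, fun F hF => orliczNorm_prod_le hΦ hΦi hC h hF⟩
  tfae_have 3 → 4 := by
    rintro ⟨M, -, h⟩ F hF
    refine ⟨Finset.measurable_fun_prod _ fun i _ => (hF i).1, orliczNorm_ne_top_iff.1 ?_⟩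
    exact ne_top_of_le_ne_top (ENNReal.mul_ne_top ENNReal.ofReal_ne_top
      (ENNReal.prod_ne_top fun i _ => orliczNorm_ne_top_iff.2 (hF i).2)) (h F hF)
  tfae_have 4 → 2 := by
    intro h
    obtain ⟨C, hC, hle⟩ := exists_prod_youngInv_le_of_memOrlicz hΦ hΦi
      (exists_measurable_nat_volume_preimage hn) h
    exact ⟨C, hC, fun t ht => map_prod_div_le_sum_of_prod_youngInv_le hΦ hΦi hC hle ht⟩
  tfae_finish
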